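/- arXiv:1811.12339 — 8 statements merged into one kernel-verified Lean document; each statement's English description precedes it below -/
import Mathlib

section
/- Let Z and Y be compact Hausdorff topological spaces and f : Z → Y a continuous map. Then f is an open map if and only if for every open subset U ⊆ Z both of the following sets are open in Y: the set {y ∈ Y | f⁻¹({y}) ⊆ U} and the set {y ∈ Y | f⁻¹({y}) ∩ U ≠ ∅}. -/
theorem isOpenMap_iff_fiber_map_vietoris_continuous {Z Y : Type*}
    [TopologicalSpace Z] [TopologicalSpace Y] [CompactSpace Z] [T2Space Z]
    [CompactSpace Y] [T2Space Y] (f : Z → Y) (hf : Continuous f) :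
    IsOpenMap f ↔
      ∀ U : Set Z, IsOpen U →
        IsOpen {y : Y | f ⁻¹' {y} ⊆ U} ∧ IsOpen {y : Y | f ⁻¹' {y} ∩ U ≠ ∅} := by
  have key : ∀ U : Set Z, {y : Y | f ⁻¹' {y} ∩ U ≠ ∅} = f '' U := by
    intro U
    ext y
    rw [Set.mem_setOf_eq, ← Set.nonempty_iff_ne_empty]
    constructor
    · rintro ⟨z, hz, hU⟩
      exact ⟨z, hU, hz⟩
    · rintro ⟨z, hU, hz⟩
      exact ⟨z, hz, hU⟩
  constructor
  · intro h U hU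
    refine ⟨?_, ?_⟩
    · have e : {y : Y | f ⁻¹' {y} ⊆ U} = (f '' Uᶜ)ᶜ := by
        ext y
        constructor
        · rintro hy ⟨z, hz, hzy⟩
          exact hz (hy hzy)
        · intro hy z hz
          by_contra hzU
          exact hy ⟨z, hzU, hz⟩
      rw [e]
      exact (hf.isClosedMap _ hU.isClosed_compl).isOpen_compl
    · rw [key]
      exact h U hU
  · intro h U hU
    rw [← key]
    exact (h U hU).2
end

section
/- Let X, Y and Z be compact Hausdorff topological spaces, and let f : Z → Y and g : Z → X be continuous maps with f an open map. Then for every open subset U ⊆ X, the sets {y ∈ Y | g[f⁻¹({y})] ⊆ U} and {y ∈ Y | g[f⁻¹({y})] ∩ U ≠ ∅} are open in Y; moreover {y ∈ Y | g[f⁻¹({y})] ∩ U ≠ ∅} = f[g⁻¹(U)]. -/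
theorem span_composite_continuous_and_diamond_preimage {X Y Z : Type*}
    [TopologicalSpace X] [TopologicalSpace Y] [TopologicalSpace Z]
    [CompactSpace X] [T2Space X] [CompactSpace Y] [T2Space Y]
    [CompactSpace Z] [T2Space Z]
    (f : Z → Y) (g : Z → X) (hf : Continuous f) (hg : Continuous g)
    (hfo : IsOpenMap f) :
    ∀ U : Set X, IsOpen U →
      IsOpen {y : Y | g '' (f ⁻¹' {y}) ⊆ U} ∧
      IsOpen {y : Y | g '' (f ⁻¹' {y}) ∩ U ≠ ∅} ∧
      {y : Y | g '' (f ⁻¹' {y}) ∩ U ≠ ∅} = f '' (g ⁻¹' U) := by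
  intro U hU
  have key : ∀ V : Set X, {y : Y | g '' (f ⁻¹' {y}) ∩ V ≠ ∅} = f '' (g ⁻¹' V) := by
    intro V
    ext y
    simp only [Set.mem_setOf_eq, ← Set.nonempty_iff_ne_empty]
    constructor
    · rintro ⟨_, ⟨z, hz, rfl⟩, hV⟩
      exact ⟨z, hV, hz⟩
    · rintro ⟨z, hV, hz⟩
      exact ⟨g z, ⟨z, hz, rfl⟩, hV⟩
  refine ⟨?_, ?_, key U⟩
  · have h : {y : Y | g '' (f ⁻¹' {y}) ⊆ U} = (f '' (g ⁻¹' Uᶜ))ᶜ := by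
      rw [← key]
      ext y
      simp only [Set.mem_setOf_eq, Set.mem_compl_iff, not_not, ne_eq]
      rw [← Set.disjoint_iff_inter_eq_empty, Set.disjoint_compl_right_iff_subset]
    rw [h]
    exact (hf.isClosedMap _ (hU.isClosed_compl.preimage hg)).isOpen_compl
  · rw [key]
    exact hfo _ (hU.preimage hg)
end

section
/- Let Z and Y be Boolean spaces (compact Hausdorff topological spaces with a basis of clopen sets) and f : Z → Y a continuous map. Then f is an open map if and only if for every clopen subset C ⊆ Z there exists a least clopen subset of Y containing f[C], i.e., a clopen D ⊆ Y with f[C] ⊆ D such that D ⊆ D' for every clopen D' ⊆ Y with f[C] ⊆ D'. -/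
theorem isOpenMap_iff_least_clopen_over_image {Z Y : Type*}
    [TopologicalSpace Z] [TopologicalSpace Y]
    [CompactSpace Z] [T2Space Z] [CompactSpace Y] [T2Space Y]
    (hZ : TopologicalSpace.IsTopologicalBasis {C : Set Z | IsClopen C})
    (hY : TopologicalSpace.IsTopologicalBasis {D : Set Y | IsClopen D})
    (f : Z → Y) (hf : Continuous f) :
    IsOpenMap f ↔
      ∀ C : Set Z, IsClopen C →
        ∃ D : Set Y, IsClopen D ∧ f '' C ⊆ D ∧
          ∀ D' : Set Y, IsClopen D' → f '' C ⊆ D' → D ⊆ D' := by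
  constructor
  · intro ho C hC
    exact ⟨f '' C, ⟨(hC.isClosed.isCompact.image hf).isClosed, ho C hC.isOpen⟩,
      subset_rfl, fun _ _ h => h⟩
  · intro h
    rw [hZ.isOpenMap_iff]
    intro C hC
    obtain ⟨D, hD, hCD, hmin⟩ := h C hC
    have hcl : IsClosed (f '' C) := (IsClopen.isClosed hC).isCompact.image hf |>.isClosed
    have hDC : D ⊆ f '' C := by
      intro y hy
      by_contra hyC
      obtain ⟨V, hV, hyV, hVC⟩ := hY.exists_subset_of_mem_open
        (show y ∈ (f '' C)ᶜ from hyC) hcl.isOpen_compl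
      exact hmin Vᶜ (IsClopen.compl hV) (Set.subset_compl_comm.mp hVC) hy hyV
    rw [hCD.antisymm hDC]
    exact hD.isOpen
end

section
/- Let S and T be sets and f : S → T any map. Then the induced map Ultrafilter.map f : Ultrafilter S → Ultrafilter T (sending an ultrafilter x on S to its pushforward along f) is an open map with respect to the Stone topologies on the ultrafilter spaces. -/
theorem ultrafilter_map_isOpenMap {S T : Type*} (f : S → T) :
    IsOpenMap (Ultrafilter.map f : Ultrafilter S → Ultrafilter T) := by
  rw [ultrafilterBasis_is_basis.isOpenMap_iff]
  rintro _ ⟨s, rfl⟩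
  have h : (Ultrafilter.map f) '' {u : Ultrafilter S | s ∈ u}
      = {v : Ultrafilter T | f '' s ∈ v} := by
    ext v
    constructor
    · rintro ⟨u, hu, rfl⟩
      exact Filter.image_mem_map hu
    · intro hv
      exact ⟨Ultrafilter.ofComapInfPrincipal hv, Ultrafilter.ofComapInfPrincipal_mem hv,
        Ultrafilter.ofComapInfPrincipal_eq_of_map hv⟩
  rw [h]
  exact ultrafilter_isOpen_basic _
end

section
/- Let S and T be sets and f : S → T any map. Then for every subset s ⊆ S, the forward image of the basic clopen set {x ∈ Ultrafilter S | s ∈ x} under Ultrafilter.map f equals the basic clopen set {y ∈ Ultrafilter T | f[s] ∈ y}, where f[s] denotes the image of s under f. -/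
theorem ultrafilter_map_image_basic_clopen {S T : Type*} (f : S → T) (s : Set S) :
    (Ultrafilter.map f) '' {x : Ultrafilter S | s ∈ x} =
      {y : Ultrafilter T | f '' s ∈ y} := by
  apply Set.Subset.antisymm
  · rintro _ ⟨x, hx, rfl⟩
    exact Filter.image_mem_map hx
  · intro y hy
    exact ⟨Ultrafilter.ofComapInfPrincipal hy, Ultrafilter.ofComapInfPrincipal_mem hy,
      Ultrafilter.ofComapInfPrincipal_eq_of_map hy⟩
end

section
/- Let A and B be types and let f : FreeSemigroup B → FreeSemigroup A be a semigroup homomorphism between the free semigroups on B and A. Then the following are equivalent: (1) the map from FreeSemigroup A to Set (FreeSemigroup B) sending w to the fiber f⁻¹({w}) is a semigroup homomorphism with respect to pointwise multiplication of sets, i.e., f⁻¹({w₁·w₂}) = f⁻¹({w₁}) · f⁻¹({w₂}) for all words w₁, w₂; (2) f is length-preserving, i.e., f maps every generator (letter) of FreeSemigroup B to a generator (letter) of FreeSemigroup A. -/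
open Pointwise

theorem of_mul_inj_aux {A : Type*} {a b : A} {v w : FreeSemigroup A}
    (h : FreeSemigroup.of a * v = FreeSemigroup.of b * w) : a = b ∧ v = w := by
  obtain ⟨v1, v2⟩ := v
  obtain ⟨w1, w2⟩ := w
  have h1 := congrArg FreeSemigroup.head h
  have h2 := congrArg FreeSemigroup.tail h
  simp at h1 h2
  obtain ⟨rfl, rfl⟩ := h2
  exact ⟨h1, rfl⟩

theorem split_head_aux {A B : Type*} (f : FreeSemigroup B →ₙ* FreeSemigroup A)
    (hf : ∀ b : B, ∃ a : A, f (FreeSemigroup.of b) = FreeSemigroup.of a)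
    (x : FreeSemigroup B) (a : A) (w : FreeSemigroup A)
    (h : f x = FreeSemigroup.of a * w) :
    ∃ b y, x = FreeSemigroup.of b * y ∧ f (FreeSemigroup.of b) = FreeSemigroup.of a ∧ f y = w := by
  induction x with
  | ih1 b =>
    obtain ⟨a', ha⟩ := hf b
    rw [ha] at h
    have h2 := congrArg FreeSemigroup.tail h
    simp at h2
  | ih2 b y _ _ =>
    obtain ⟨a', ha⟩ := hf b
    rw [map_mul, ha] at h
    obtain ⟨rfl, h2⟩ := of_mul_inj_aux h
    exact ⟨b, y, rfl, ha, h2⟩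

theorem split_aux {A B : Type*} (f : FreeSemigroup B →ₙ* FreeSemigroup A)
    (hf : ∀ b : B, ∃ a : A, f (FreeSemigroup.of b) = FreeSemigroup.of a)
    (w₁ w₂ : FreeSemigroup A) : ∀ x : FreeSemigroup B, f x = w₁ * w₂ →
    ∃ y z, f y = w₁ ∧ f z = w₂ ∧ y * z = x := by
  induction w₁ with
  | ih1 a =>
    intro x h
    obtain ⟨b, y, rfl, h1, h2⟩ := split_head_aux f hf x a w₂ h
    exact ⟨_, y, h1, h2, rfl⟩
  | ih2 a w _ ih =>
    intro x h
    rw [mul_assoc] at h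
    obtain ⟨b, y, rfl, h1, h2⟩ := split_head_aux f hf x a _ h
    obtain ⟨u, v, hu, hv, rfl⟩ := ih y h2
    exact ⟨FreeSemigroup.of b * u, v, by rw [map_mul, h1, hu], hv, mul_assoc _ _ _⟩

theorem fiber_map_hom_iff_length_preserving {A B : Type*}
    (f : FreeSemigroup B →ₙ* FreeSemigroup A) :
    (∀ w₁ w₂ : FreeSemigroup A,
        f ⁻¹' {w₁ * w₂} = (f ⁻¹' {w₁}) * (f ⁻¹' {w₂})) ↔
      (∀ b : B, ∃ a : A, f (FreeSemigroup.of b) = FreeSemigroup.of a) := by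
  constructor
  · intro h b
    induction hw : f (FreeSemigroup.of b) with
    | ih1 a => exact ⟨a, rfl⟩
    | ih2 a w _ _ =>
      exfalso
      have hm : FreeSemigroup.of b ∈ f ⁻¹' {FreeSemigroup.of a * w} := hw
      rw [h] at hm
      obtain ⟨y, _, z, _, hyz⟩ := Set.mem_mul.1 hm
      have h2 := congrArg FreeSemigroup.tail hyz
      simp at h2
  · intro hf w₁ w₂
    ext x
    rw [Set.mem_mul]
    constructor
    · intro hx
      obtain ⟨y, z, hy, hz, e⟩ := split_aux f hf w₁ w₂ x hx
      exact ⟨y, hy, z, hz, e⟩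
    · rintro ⟨y, hy, z, hz, rfl⟩
      have hy' : f y = w₁ := hy
      have hz' : f z = w₂ := hz
      show f (y * z) = w₁ * w₂
      rw [map_mul, hy', hz']
end

section
/- Let A be a type, S a semigroup, and h : FreeSemigroup A → Set S a semigroup homomorphism, where Set S carries pointwise multiplication. Then the subsemigroup R = {(u, s) ∈ FreeSemigroup A × S | s ∈ h(u)} of the product semigroup FreeSemigroup A × S is generated by the set {(a, s) | a is a letter of A and s ∈ h(a)} (identifying a letter a with the corresponding generator of FreeSemigroup A). -/
open Pointwise

theorem span_subsemigroup_generated_by_letters {A : Type*} {S : Type*} [Semigroup S]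
    (h : FreeSemigroup A →ₙ* Set S) :
    {p : FreeSemigroup A × S | p.2 ∈ h p.1} =
      ↑(Subsemigroup.closure
          {p : FreeSemigroup A × S | ∃ a : A, p.1 = FreeSemigroup.of a ∧ p.2 ∈ h p.1}) := by
  apply Set.Subset.antisymm
  · rintro ⟨u, s⟩ hs
    change s ∈ h u at hs
    induction u using FreeSemigroup.recOnMul generalizing s with
    | ih1 a => exact Subsemigroup.subset_closure ⟨a, rfl, hs⟩
    | ih2 a v iha ihv =>
      rw [map_mul] at hs
      obtain ⟨x, hx, y, hy, rfl⟩ := Set.mem_mul.mp hs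
      exact Subsemigroup.mul_mem _ (iha x hx) (ihv y hy)
  · intro p hp
    change p ∈ Subsemigroup.closure _ at hp
    induction hp using Subsemigroup.closure_induction with
    | mem p hp => exact hp.choose_spec.2
    | mul p q _ _ ihp ihq =>
      change p.2 * q.2 ∈ h (p.1 * q.1)
      rw [map_mul]
      exact Set.mul_mem_mul ihp ihq
end

section
/- Every finite semigroup divides a power semigroup of an aperiodic finite semigroup: for every finite semigroup M there exist a finite aperiodic semigroup S (i.e., for every s ∈ S there is n ≥ 1 with s^{n+1} = s^n), a subsemigroup R of the powerset semigroup P(S) with pointwise multiplication, and a surjective semigroup homomorphism from R onto M. -/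
open Pointwise

/-- `spow s n` is `s ^ (n + 1)` in a semigroup (which need not have a unit). -/
def spow {S : Type*} [Semigroup S] (s : S) : ℕ → S
  | 0 => s
  | n + 1 => spow s n * s

/-- The aperiodic Brandt semigroup over `Q`: pairs of elements of `Q` together with a zero. -/
def Brandt (Q : Type) : Type := Option (Q × Q)

open Classical in
/-- Multiplication in the Brandt semigroup. -/
noncomputable def Brandt.mul {Q : Type} :
    Option (Q × Q) → Option (Q × Q) → Option (Q × Q)
  | some a, some b => if a.2 = b.1 then some (a.1, b.2) else none
  | none, _ => none
  | some _, none => none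

theorem Brandt.mul_assoc {Q : Type} (a b c : Option (Q × Q)) :
    Brandt.mul (Brandt.mul a b) c = Brandt.mul a (Brandt.mul b c) := by
  rcases a with _ | ⟨a, a'⟩ <;> rcases b with _ | ⟨b, b'⟩ <;> rcases c with _ | ⟨c, c'⟩ <;>
    try simp [Brandt.mul]
  · by_cases h : a' = b <;> simp [h]
  · by_cases h : a' = b <;> by_cases h2 : b' = c <;> simp [h, h2]

noncomputable instance Brandt.semigroup (Q : Type) : Semigroup (Brandt Q) where
  mul := Brandt.mul
  mul_assoc a b c := by
    exact Brandt.mul_assoc a b c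

/-- The subset of the Brandt semigroup that encodes a transformation. -/
def Brandt.graph {Q : Type} (f : Q → Q) : Set (Brandt Q) :=
  {x | x = none ∨ ∃ p, x = some (p, f p)}

theorem Brandt.graph_mul {Q : Type} (f g : Q → Q) :
    Brandt.graph f * Brandt.graph g = Brandt.graph (fun p => g (f p)) := by
  ext x
  rw [Set.mem_mul]
  constructor
  · rintro ⟨a, ha, b, hb, rfl⟩
    change Brandt.mul a b ∈ _
    rcases ha with rfl | ⟨p, rfl⟩
    · exact Or.inl rfl
    rcases hb with rfl | ⟨q, rfl⟩
    · exact Or.inl rfl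
    by_cases h : f p = q
    · subst h
      exact Or.inr ⟨p, by simp [Brandt.mul]; rfl⟩
    · exact Or.inl (by simp [Brandt.mul, h]; rfl)
  · rintro (rfl | ⟨p, rfl⟩)
    · exact ⟨none, Or.inl rfl, none, Or.inl rfl, rfl⟩
    · refine ⟨some (p, f p), Or.inr ⟨p, rfl⟩, some (f p, g (f p)), Or.inr ⟨f p, rfl⟩, ?_⟩
      change Brandt.mul _ _ = _
      simp [Brandt.mul]

theorem Brandt.graph_injective {Q : Type} : Function.Injective (Brandt.graph (Q := Q)) := by
  intro f g h
  funext p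
  have hp : (some (p, f p) : Option (Q × Q)) ∈ Brandt.graph g := by
    rw [← h]
    exact Or.inr ⟨p, rfl⟩
  rcases hp with hp | ⟨q, hq⟩
  · cases hp
  · have := Option.some.inj hq
    simp only [Prod.mk.injEq] at this
    obtain ⟨rfl, h2⟩ := this
    exact h2

/-- Right translations of a semigroup with an identity adjoined, transported along `e`. -/
def rightAct {M : Type*} [Semigroup M] {n : ℕ} (e : M ≃ Fin n) (m : M) :
    Option (Fin n) → Option (Fin n)
  | none => some (e m)
  | some p => some (e (e.symm p * m))

theorem rightAct_mul {M : Type*} [Semigroup M] {n : ℕ} (e : M ≃ Fin n) (a b : M) :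
    (fun p => rightAct e b (rightAct e a p)) = rightAct e (a * b) := by
  funext p
  cases p <;> simp [rightAct, mul_assoc]

theorem rightAct_injective {M : Type*} [Semigroup M] {n : ℕ} (e : M ≃ Fin n) :
    Function.Injective (rightAct e) := by
  intro a b h
  simpa [rightAct] using congrFun h none

theorem finite_semigroup_divides_power_of_aperiodic (M : Type*) [Semigroup M] [Finite M] :
    ∃ (S : Type) (_ : Semigroup S) (_ : Fintype S),
      (∀ s : S, ∃ n : ℕ, 1 ≤ n ∧ spow s n = spow s (n - 1)) ∧
      ∃ (R : Subsemigroup (Set S)) (φ : R →ₙ* M), Function.Surjective φ := by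
  obtain ⟨n, ⟨e⟩⟩ := Finite.exists_equiv_fin M
  let F : M → Set (Brandt (Option (Fin n))) := fun m => Brandt.graph (rightAct e m)
  have hF : ∀ a b, F a * F b = F (a * b) := fun a b => by
    simp only [F, Brandt.graph_mul, rightAct_mul]
  have hi : Function.Injective F := Brandt.graph_injective.comp (rightAct_injective e)
  refine ⟨Brandt (Option (Fin n)), inferInstance,
    inferInstanceAs (Fintype (Option (Option (Fin n) × Option (Fin n)))), ?_, ?_⟩
  · intro s
    refine ⟨2, by norm_num, ?_⟩
    change Brandt.mul (Brandt.mul s s) s = Brandt.mul s s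
    rcases s with _ | ⟨p, q⟩
    · rfl
    · by_cases h : q = p <;> simp [Brandt.mul, h]
  · let R : Subsemigroup (Set (Brandt (Option (Fin n)))) :=
      { carrier := Set.range F
        mul_mem' := by
          rintro _ _ ⟨a, rfl⟩ ⟨b, rfl⟩
          exact ⟨a * b, (hF a b).symm⟩ }
    have hc : ∀ x : R, ∃ m, F m = x.1 := fun x => x.2
    choose φ hφ using hc
    refine ⟨R, ⟨φ, fun x y => hi ?_⟩, fun m => ⟨⟨F m, m, rfl⟩, hi ?_⟩⟩
    · rw [hφ, ← hF, hφ, hφ]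
      rfl
    · exact hφ _
end
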